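/- Assume R_p < p^k for every prime p, and let ρ = ∏_p (1 − R_p·p^{−k}). Let p be a prime, l ≥ 1 an integer and a ∈ ℕ with p ∤ a, and let H_1,…,H_{R_p} be the distinct residues of h_1,…,h_r modulo p^k. Then Σ_{ν=1}^{p^l} e(aν/p^l) · η(p^l, ν) equals ρ · (−p^{−k}/(1 − R_p·p^{−k})) · Σ_{n=1}^{R_p} e(−a·H_n/p^l) if l ≤ k, and equals 0 if l > k. -/

import Mathlib

open scoped BigOperators Classical

noncomputable section

/-- `n` is `k`-free: no `k`-th power of a prime divides `n`. -/
def KFree (k n : ℕ) : Prop := ∀ p : ℕ, p.Prime → ¬ p ^ k ∣ n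

/-- The density `η(q,a)` of the `k`-free `r`-tuples (with shifts `h`) in the residue class
`a mod q`. -/
def eta (k r : ℕ) (h : Fin r → ℕ) (q a : ℕ) : ℝ :=
  ∑' d : Fin r → ℕ,
    if (∀ i, 1 ≤ d i) ∧
        (∀ i j, ((Nat.gcd (d i ^ k) (d j ^ k) : ℤ) ∣ (h i : ℤ) - (h j : ℤ))) ∧
        (∀ i, Nat.gcd q (d i ^ k) ∣ a + h i)
    then (∏ i, (ArithmeticFunction.moebius (d i) : ℝ)) /
          ((Nat.lcm q (Finset.univ.lcm fun i => d i ^ k) : ℕ) : ℝ)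
    else 0

/-- The number of `n ≤ x` with `n ∈ ℛ` (i.e. all `n + h i` are `k`-free) and
`n ≡ a (mod q)`. -/
def countR (k r : ℕ) (h : Fin r → ℕ) (x : ℝ) (q a : ℕ) : ℕ :=
  ((Finset.Icc 1 ⌊x⌋₊).filter fun n => (∀ i, KFree k (n + h i)) ∧ n % q = a % q).card

/-- The error term `E_x(q,a)`. -/
def Ex (k r : ℕ) (h : Fin r → ℕ) (x : ℝ) (q a : ℕ) : ℝ :=
  (countR k r h x q a : ℝ) - eta k r h q a * x

/-- `R_p`: the number of distinct residues of `h_1, …, h_r` modulo `p^k`. -/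
def Rp (k r : ℕ) (h : Fin r → ℕ) (p : ℕ) : ℕ :=
  ((Finset.univ : Finset (Fin r)).image fun i => h i % p ^ k).card

/-- `e(x) = e^{2πix}`. -/
def eF (x : ℝ) : ℂ := Complex.exp (2 * Real.pi * Complex.I * x)

/-- The distinct residues of `h_1, …, h_r` modulo `p^k`. -/
def residues (k r : ℕ) (h : Fin r → ℕ) (p : ℕ) : Finset ℕ :=
  (Finset.univ : Finset (Fin r)).image fun i => h i % p ^ k

/-- `ρ = ∏_p (1 − R_p·p^{−k})`. -/
def rho (k r : ℕ) (h : Fin r → ℕ) : ℝ :=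
  ∏' p : Nat.Primes, (1 - (Rp k r h (p : ℕ) : ℝ) / (p : ℕ) ^ k)

theorem summable_pi_prod {ι α : Type*} [Fintype ι] {f : α → ℝ} (hf : 0 ≤ f)
    (hs : Summable f) : Summable fun d : ι → α => ∏ i, f (d i) := by
  refine summable_of_sum_le (c := ∏ _i : ι, ∑' x, f x)
    (fun d => Finset.prod_nonneg fun i _ => hf _) fun s => ?_
  let t : ι → Finset α := fun i => s.image fun d => d i
  calc ∑ d ∈ s, ∏ i, f (d i) ≤ ∑ d ∈ Fintype.piFinset t, ∏ i, f (d i) := by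
        refine Finset.sum_le_sum_of_subset_of_nonneg (fun d hd => ?_)
          fun d _ _ => Finset.prod_nonneg fun i _ => hf _
        exact Fintype.mem_piFinset.2 fun i => Finset.mem_image_of_mem _ hd
    _ = ∏ i, ∑ x ∈ t i, f x := (Finset.prod_univ_sum _ _).symm
    _ ≤ _ := Finset.prod_le_prod (fun i _ => Finset.sum_nonneg fun x _ => hf x)
        fun i _ => hs.sum_le_tsum _ fun x _ => hf x

theorem gcd_prod_dvd_prod_gcd {ι : Type*} (s : Finset ι) (m : ℕ) (x : ι → ℕ) :
    Nat.gcd m (∏ i ∈ s, x i) ∣ ∏ i ∈ s, Nat.gcd m (x i) := by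
  induction s using Finset.induction_on with
  | empty => simp
  | insert a s ha ih =>
    rw [Finset.prod_insert ha, Finset.prod_insert ha]
    exact (Nat.gcd_mul_right_dvd_mul_gcd _ _ _).trans (mul_dvd_mul_left _ ih)

theorem lcm_dvd_prod {ι : Type*} (s : Finset ι) (x : ι → ℕ) : s.lcm x ∣ ∏ i ∈ s, x i :=
  Finset.lcm_dvd fun _ hi => Finset.dvd_prod_of_mem x hi

/-- If all pairwise gcds are bounded then the lcm is comparable to the product. -/
theorem exists_prod_le_mul_lcm {ι : Type*} (s : Finset ι) (M : ℕ) :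
    ∃ C : ℕ, ∀ x : ι → ℕ, (∀ i, 1 ≤ x i) → (∀ i j, i ≠ j → Nat.gcd (x i) (x j) ≤ M) →
      ∏ i ∈ s, x i ≤ C * s.lcm x := by
  induction s using Finset.induction_on with
  | empty => exact ⟨1, by simp⟩
  | insert a s ha ih =>
    obtain ⟨C, hC⟩ := ih
    refine ⟨C * M ^ s.card, fun x hx hM => ?_⟩
    have hgcd : Nat.gcd (x a) (s.lcm x) ≤ M ^ s.card := by
      calc Nat.gcd (x a) (s.lcm x) ≤ ∏ i ∈ s, Nat.gcd (x a) (x i) :=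
            Nat.le_of_dvd (Finset.prod_pos fun i _ => Nat.gcd_pos_of_pos_left _ (hx a))
              ((Nat.gcd_dvd_gcd_of_dvd_right _ (lcm_dvd_prod s x)).trans
                (gcd_prod_dvd_prod_gcd s _ x))
        _ ≤ ∏ _i ∈ s, M := Finset.prod_le_prod' fun i hi =>
            hM a i fun h => ha (h ▸ hi)
        _ = M ^ s.card := by simp
    rw [Finset.prod_insert ha, Finset.lcm_insert]
    calc x a * ∏ i ∈ s, x i ≤ x a * (C * s.lcm x) := Nat.mul_le_mul_left _ (hC x hx hM)
      _ = C * (Nat.gcd (x a) (s.lcm x) * Nat.lcm (x a) (s.lcm x)) := by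
          rw [Nat.gcd_mul_lcm]; ring
      _ ≤ C * (M ^ s.card * Nat.lcm (x a) (s.lcm x)) := by gcongr
      _ = _ := by rw [mul_assoc]; rfl

theorem lcm_pow_eq {ι : Type*} (s : Finset ι) (x : ι → ℕ) (k : ℕ) :
    (s.lcm fun i => x i ^ k) = s.lcm x ^ k := by
  induction s using Finset.induction_on with
  | empty => simp
  | insert a s ha ih =>
    rw [Finset.lcm_insert, Finset.lcm_insert, ih]
    exact Nat.pow_lcm_pow

theorem lcm_mul_of_coprime {ι : Type*} (s : Finset ι) {d e : ι → ℕ}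
    (hde : Nat.Coprime (s.lcm d) (s.lcm e)) :
    (s.lcm fun i => d i * e i) = s.lcm d * s.lcm e := by
  refine Nat.dvd_antisymm
    (Finset.lcm_dvd fun i hi => mul_dvd_mul (Finset.dvd_lcm hi) (Finset.dvd_lcm hi)) ?_
  refine hde.mul_dvd_of_dvd_of_dvd (Finset.lcm_dvd fun i hi => ?_) (Finset.lcm_dvd fun i hi => ?_)
  · exact (dvd_mul_right _ _).trans (Finset.dvd_lcm (f := fun i => d i * e i) hi)
  · exact (dvd_mul_left _ _).trans (Finset.dvd_lcm (f := fun i => d i * e i) hi)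

theorem lcm_gcd_of_coprime {ι : Type*} (s : Finset ι) {x : ι → ℕ} {D E : ℕ}
    (hDE : Nat.Coprime D E) (hx : s.lcm x = D * E) :
    (s.lcm fun i => Nat.gcd (x i) D) = D := by
  refine Nat.dvd_antisymm (Finset.lcm_dvd fun i _ => Nat.gcd_dvd_right _ _) ?_
  have hE : (s.lcm fun i => Nat.gcd (x i) E) ∣ E := Finset.lcm_dvd fun i _ => Nat.gcd_dvd_right _ _
  refine Nat.Coprime.dvd_of_dvd_mul_right (hDE.coprime_dvd_right hE) ?_
  refine (Dvd.intro E rfl : D ∣ D * E).trans (hx ▸ Finset.lcm_dvd fun i hi => ?_)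
  have h1 : x i ∣ D * E := hx ▸ Finset.dvd_lcm hi
  rw [← Nat.gcd_eq_left h1, hDE.gcd_mul]
  exact mul_dvd_mul (Finset.dvd_lcm (f := fun i => Nat.gcd (x i) D) hi)
    (Finset.dvd_lcm (f := fun i => Nat.gcd (x i) E) hi)

/-- The tuples `d` over which the sum defining `eta` runs. -/
def Admissible (k r : ℕ) (h : Fin r → ℕ) (q a : ℕ) (d : Fin r → ℕ) : Prop :=
  (∀ i, 1 ≤ d i) ∧
    (∀ i j, ((Nat.gcd (d i ^ k) (d j ^ k) : ℤ) ∣ (h i : ℤ) - (h j : ℤ))) ∧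
    (∀ i, Nat.gcd q (d i ^ k) ∣ a + h i)

/-- The summand of `q * eta k r h q a`. -/
def etaTerm (k r : ℕ) (h : Fin r → ℕ) (q a : ℕ) (d : Fin r → ℕ) : ℝ :=
  if Admissible k r h q a d then
    (∏ i, (ArithmeticFunction.moebius (d i) : ℝ)) *
      ((Nat.gcd q (Finset.univ.lcm d ^ k) : ℕ) / ((Finset.univ.lcm d : ℕ) : ℝ) ^ k)
  else 0

/-- The tuples of positive integers with least common multiple `D`. -/
def lcmFiber (r D : ℕ) : Finset (Fin r → ℕ) :=
  (Fintype.piFinset fun _ : Fin r => D.divisors).filter fun d => Finset.univ.lcm d = D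

/-- The part of `q * eta k r h q a` coming from tuples with least common multiple `D`. -/
def lcmSum (k r : ℕ) (h : Fin r → ℕ) (q a D : ℕ) : ℝ :=
  ∑ d ∈ lcmFiber r D, etaTerm k r h q a d

theorem lcm_pos_of_pos {r : ℕ} {d : Fin r → ℕ} (hd : ∀ i, 1 ≤ d i) :
    0 < Finset.univ.lcm d :=
  Nat.pos_of_ne_zero fun h0 => by
    obtain ⟨i, -, hi⟩ := Finset.lcm_eq_zero_iff.1 h0
    exact absurd (hd i) (by simp [hi])

theorem mem_lcmFiber {r D : ℕ} {d : Fin r → ℕ} :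
    d ∈ lcmFiber r D ↔ (∀ i, 1 ≤ d i) ∧ Finset.univ.lcm d = D := by
  simp only [lcmFiber, Finset.mem_filter, Fintype.mem_piFinset, Nat.mem_divisors]
  constructor
  · rintro ⟨h1, h2⟩
    exact ⟨fun i => Nat.pos_of_dvd_of_pos (h1 i).1 (Nat.pos_of_ne_zero (h1 i).2), h2⟩
  · rintro ⟨h1, rfl⟩
    exact ⟨fun i => ⟨Finset.dvd_lcm (Finset.mem_univ i), (lcm_pos_of_pos h1).ne'⟩, rfl⟩

theorem mul_eta_eq_tsum (k r : ℕ) (h : Fin r → ℕ) {q : ℕ} (hq : 0 < q) (a : ℕ) :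
    (q : ℝ) * eta k r h q a = ∑' d, etaTerm k r h q a d := by
  rw [eta, ← tsum_mul_left]
  refine tsum_congr fun d => ?_
  unfold etaTerm
  by_cases hd : Admissible k r h q a d
  · have hd' := hd
    unfold Admissible at hd'
    rw [if_pos hd, if_pos hd', lcm_pow_eq]
    set L := Finset.univ.lcm d
    have hL0 : 0 < L ^ k := pow_pos (lcm_pos_of_pos hd.1) k
    have hmul : (Nat.gcd q (L ^ k) : ℝ) * (Nat.lcm q (L ^ k) : ℕ) = q * (L : ℝ) ^ k := by
      exact_mod_cast Nat.gcd_mul_lcm q (L ^ k)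
    have h1 : ((Nat.lcm q (L ^ k) : ℕ) : ℝ) ≠ 0 := by
      exact_mod_cast (Nat.lcm_pos hq hL0).ne'
    have h2 : (L : ℝ) ^ k ≠ 0 := by exact_mod_cast hL0.ne'
    field_simp
    linear_combination (-(∏ i, (ArithmeticFunction.moebius (d i) : ℝ))) * hmul
  · have hd' := hd
    unfold Admissible at hd'
    rw [if_neg hd, if_neg hd', mul_zero]

theorem summable_etaTerm {k r : ℕ} (hk : 2 ≤ k) {h : Fin r → ℕ} (hh : Function.Injective h)
    {q : ℕ} (hq : 0 < q) (a : ℕ) : Summable fun d => ‖etaTerm k r h q a d‖ := by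
  obtain ⟨C, hC⟩ := exists_prod_le_mul_lcm (Finset.univ : Finset (Fin r)) (∑ i, h i)
  have hs : Summable fun d : Fin r → ℕ => ∏ i, (((d i : ℕ) : ℝ) ^ k)⁻¹ :=
    summable_pi_prod (f := fun n : ℕ => ((n : ℝ) ^ k)⁻¹) (fun n => by positivity)
      (Real.summable_nat_pow_inv.2 (by omega))
  refine Summable.of_nonneg_of_le (fun d => norm_nonneg _) (fun d => ?_) (hs.mul_left (q * C : ℝ))
  unfold etaTerm
  split_ifs with hd
  · have hbd := hC (fun i => d i ^ k) (fun i => Nat.one_le_pow _ _ (hd.1 i)) fun i j hij => by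
      have hne : (h i : ℤ) - h j ≠ 0 := fun h0 => hij (hh (by omega))
      have h1 := Int.natAbs_dvd_natAbs.2 (hd.2.1 i j)
      rw [Int.natAbs_natCast] at h1
      have h2 := Nat.le_of_dvd (Int.natAbs_pos.2 hne) h1
      have h3 := Finset.single_le_sum (f := h) (fun _ _ => Nat.zero_le _) (Finset.mem_univ i)
      have h4 := Finset.single_le_sum (f := h) (fun _ _ => Nat.zero_le _) (Finset.mem_univ j)
      omega
    rw [lcm_pow_eq] at hbd
    have hL0 : 0 < Finset.univ.lcm d ^ k := pow_pos (lcm_pos_of_pos hd.1) k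
    have hP0 : 0 < ∏ i, d i ^ k := Finset.prod_pos fun i _ => pow_pos (hd.1 i) k
    set L := Finset.univ.lcm d
    have hmu : ‖∏ i, (ArithmeticFunction.moebius (d i) : ℝ)‖ ≤ 1 := by
      rw [norm_prod]
      refine Finset.prod_le_one (fun _ _ => norm_nonneg _) fun i _ => ?_
      rw [Real.norm_eq_abs]
      exact_mod_cast ArithmeticFunction.abs_moebius_le_one (n := d i)
    have hg : (Nat.gcd q (L ^ k) : ℝ) ≤ q := by exact_mod_cast Nat.gcd_le_left _ hq
    have hL1 : (0 : ℝ) < (L : ℝ) ^ k := by exact_mod_cast hL0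
    have hP1 : (0 : ℝ) < ∏ i, (d i : ℝ) ^ k := by exact_mod_cast hP0
    have hbd' : (∏ i, (d i : ℝ) ^ k) ≤ C * (L : ℝ) ^ k := by exact_mod_cast hbd
    rw [norm_mul, Finset.prod_inv_distrib]
    calc _ ≤ 1 * ((q : ℝ) / (L : ℝ) ^ k) := by
          refine mul_le_mul hmu ?_ (norm_nonneg _) zero_le_one
          rw [Real.norm_of_nonneg (by positivity)]
          gcongr
      _ ≤ q * C * (∏ i, (d i : ℝ) ^ k)⁻¹ := by
          rw [one_mul, ← div_eq_mul_inv, div_le_div_iff₀ hL1 hP1, mul_assoc]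
          gcongr
  · rw [norm_zero]; positivity

theorem hasSum_etaTerm_lcmFiber (k r : ℕ) (h : Fin r → ℕ) (q a D : ℕ) :
    HasSum (fun d : (fun d : Fin r → ℕ => Finset.univ.lcm d) ⁻¹' {D} => etaTerm k r h q a d)
      (lcmSum k r h q a D) := by
  have := hasSum_sum_of_ne_finset_zero (s := lcmFiber r D) (L := .unconditional _)
    (f := Set.indicator ((fun d : Fin r → ℕ => Finset.univ.lcm d) ⁻¹' {D}) (etaTerm k r h q a))
    fun d hd => by
      by_cases hD : Finset.univ.lcm d = D
      · rw [Set.indicator_of_mem (by simpa using hD), etaTerm,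
          if_neg fun hadm => hd (mem_lcmFiber.2 ⟨hadm.1, hD⟩)]
      · exact Set.indicator_of_notMem (by simpa using hD) _
  rw [← hasSum_subtype_iff_indicator] at this
  convert this using 1
  · rfl
  refine Finset.sum_congr rfl fun d hd => ?_
  rw [Set.indicator_of_mem (by simpa using (mem_lcmFiber.1 hd).2)]

theorem coprime_of_lcm {r : ℕ} {d e : Fin r → ℕ}
    (hde : Nat.Coprime (Finset.univ.lcm d) (Finset.univ.lcm e)) (i j : Fin r) :
    Nat.Coprime (d i) (e j) :=
  Nat.Coprime.of_dvd (Finset.dvd_lcm (Finset.mem_univ i)) (Finset.dvd_lcm (Finset.mem_univ j)) hde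

theorem gcd_mul_pow_mul_pow {a b c d : ℕ} (k : ℕ) (hab : Nat.Coprime a b) (had : Nat.Coprime a d)
    (hcb : Nat.Coprime c b) (hcd : Nat.Coprime c d) :
    Nat.gcd ((a * b) ^ k) ((c * d) ^ k) = Nat.gcd (a ^ k) (c ^ k) * Nat.gcd (b ^ k) (d ^ k) := by
  rw [mul_pow, mul_pow, (hab.pow k k).mul_gcd, (hcd.pow k k).gcd_mul, (hcd.pow k k).gcd_mul,
    (had.pow k k).gcd_eq_one, (hcb.symm.pow k k).gcd_eq_one, mul_one, one_mul]

theorem admissible_mul {k r : ℕ} {h : Fin r → ℕ} {q a : ℕ} {d e : Fin r → ℕ}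
    (hde : Nat.Coprime (Finset.univ.lcm d) (Finset.univ.lcm e)) :
    Admissible k r h q a (fun i => d i * e i) ↔
      Admissible k r h q a d ∧ Admissible k r h q a e := by
  have hc := coprime_of_lcm hde
  have h1 : ∀ i, 1 ≤ d i * e i ↔ 1 ≤ d i ∧ 1 ≤ e i := fun i => by
    simp only [Nat.one_le_iff_ne_zero, ne_eq, mul_eq_zero, not_or]
  have h2 : ∀ i j, ((Nat.gcd ((d i * e i) ^ k) ((d j * e j) ^ k) : ℤ) ∣ (h i : ℤ) - (h j : ℤ)) ↔
      ((Nat.gcd (d i ^ k) (d j ^ k) : ℤ) ∣ (h i : ℤ) - (h j : ℤ)) ∧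
      ((Nat.gcd (e i ^ k) (e j ^ k) : ℤ) ∣ (h i : ℤ) - (h j : ℤ)) := fun i j => by
    have hco : Nat.Coprime (Nat.gcd (d i ^ k) (d j ^ k)) (Nat.gcd (e i ^ k) (e j ^ k)) :=
      Nat.Coprime.of_dvd (Nat.gcd_dvd_left _ _) (Nat.gcd_dvd_left _ _) ((hc i i).pow k k)
    rw [gcd_mul_pow_mul_pow k (hc i i) (hc i j) (hc j i) (hc j j), Int.natCast_dvd,
      Int.natCast_dvd, Int.natCast_dvd]
    exact ⟨fun H => ⟨dvd_of_mul_right_dvd H, dvd_of_mul_left_dvd H⟩,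
      fun H => hco.mul_dvd_of_dvd_of_dvd H.1 H.2⟩
  have h3 : ∀ i, Nat.gcd q ((d i * e i) ^ k) ∣ a + h i ↔
      Nat.gcd q (d i ^ k) ∣ a + h i ∧ Nat.gcd q (e i ^ k) ∣ a + h i := fun i => by
    have hco : Nat.Coprime (Nat.gcd q (d i ^ k)) (Nat.gcd q (e i ^ k)) :=
      Nat.Coprime.of_dvd (Nat.gcd_dvd_right _ _) (Nat.gcd_dvd_right _ _) ((hc i i).pow k k)
    rw [mul_pow, ((hc i i).pow k k).gcd_mul]
    exact ⟨fun H => ⟨dvd_of_mul_right_dvd H, dvd_of_mul_left_dvd H⟩,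
      fun H => hco.mul_dvd_of_dvd_of_dvd H.1 H.2⟩
  simp only [Admissible, h1, h2, h3, forall_and]
  tauto

theorem etaTerm_mul {k r : ℕ} {h : Fin r → ℕ} {q a : ℕ} {d e : Fin r → ℕ}
    (hde : Nat.Coprime (Finset.univ.lcm d) (Finset.univ.lcm e)) :
    etaTerm k r h q a (fun i => d i * e i) = etaTerm k r h q a d * etaTerm k r h q a e := by
  unfold etaTerm
  by_cases hd : Admissible k r h q a d
  · by_cases he : Admissible k r h q a e
    · rw [if_pos hd, if_pos he, if_pos ((admissible_mul hde).2 ⟨hd, he⟩),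
        lcm_mul_of_coprime _ hde, mul_pow, (hde.pow k k).gcd_mul]
      have hmu : ∀ i, (ArithmeticFunction.moebius (d i * e i) : ℝ) =
          ArithmeticFunction.moebius (d i) * ArithmeticFunction.moebius (e i) := fun i => by
        rw [ArithmeticFunction.isMultiplicative_moebius.map_mul_of_coprime (coprime_of_lcm hde i i),
          Int.cast_mul]
      simp only [hmu, Finset.prod_mul_distrib]
      push_cast
      rw [mul_pow]
      ring
    · rw [if_neg he, if_neg fun H => he ((admissible_mul hde).1 H).2, mul_zero]
  · rw [if_neg hd, if_neg fun H => hd ((admissible_mul hde).1 H).1, zero_mul]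

theorem lcmSum_mul (k r : ℕ) (h : Fin r → ℕ) (q a : ℕ) {D E : ℕ} (hDE : Nat.Coprime D E) :
    lcmSum k r h q a (D * E) = lcmSum k r h q a D * lcmSum k r h q a E := by
  unfold lcmSum
  rw [Finset.sum_mul_sum, ← Finset.sum_product']
  symm
  refine Finset.sum_nbij' (fun x i => x.1 i * x.2 i)
    (fun x => (fun i => Nat.gcd (x i) D, fun i => Nat.gcd (x i) E)) ?_ ?_ ?_ ?_ ?_
  · rintro ⟨d, e⟩ hx
    simp only [Finset.mem_product, mem_lcmFiber] at hx ⊢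
    obtain ⟨⟨hd, rfl⟩, he, rfl⟩ := hx
    exact ⟨fun i => Nat.mul_pos (hd i) (he i), lcm_mul_of_coprime _ hDE⟩
  · intro x hx
    simp only [Finset.mem_product, mem_lcmFiber] at hx ⊢
    refine ⟨⟨fun i => Nat.gcd_pos_of_pos_left _ (hx.1 i), lcm_gcd_of_coprime _ hDE hx.2⟩,
      fun i => Nat.gcd_pos_of_pos_left _ (hx.1 i), lcm_gcd_of_coprime _ hDE.symm ?_⟩
    rw [hx.2, mul_comm]
  · rintro ⟨d, e⟩ hx
    simp only [Finset.mem_product, mem_lcmFiber] at hx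
    obtain ⟨⟨hd, rfl⟩, he, rfl⟩ := hx
    have hdD : ∀ i, d i ∣ Finset.univ.lcm d := fun i => Finset.dvd_lcm (Finset.mem_univ i)
    have heE : ∀ i, e i ∣ Finset.univ.lcm e := fun i => Finset.dvd_lcm (Finset.mem_univ i)
    refine Prod.ext (funext fun i => ?_) (funext fun i => ?_)
    · have : Nat.Coprime (e i) (Finset.univ.lcm d) := (hDE.coprime_dvd_right (heE i)).symm
      simp only [this.gcd_mul_right_cancel, Nat.gcd_eq_left (hdD i)]
    · have : Nat.Coprime (d i) (Finset.univ.lcm e) := hDE.coprime_dvd_left (hdD i)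
      simp only [this.gcd_mul_left_cancel, Nat.gcd_eq_left (heE i)]
  · intro x hx
    obtain ⟨-, hx⟩ := mem_lcmFiber.1 hx
    funext i
    have h1 : x i ∣ D * E := hx ▸ Finset.dvd_lcm (Finset.mem_univ i)
    rw [← hDE.gcd_mul, Nat.gcd_eq_left h1]
  · rintro ⟨d, e⟩ hx
    simp only [Finset.mem_product, mem_lcmFiber] at hx
    obtain ⟨⟨hd, rfl⟩, he, rfl⟩ := hx
    exact (etaTerm_mul hDE).symm

theorem lcmSum_zero (k r : ℕ) (h : Fin r → ℕ) (q a : ℕ) : lcmSum k r h q a 0 = 0 :=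
  Finset.sum_eq_zero fun _ hd =>
    absurd (mem_lcmFiber.1 hd).2 (lcm_pos_of_pos (mem_lcmFiber.1 hd).1).ne'

theorem lcmSum_one (k r : ℕ) (h : Fin r → ℕ) (q a : ℕ) : lcmSum k r h q a 1 = 1 := by
  have hfib : lcmFiber r 1 = {fun _ => 1} := by
    ext d
    rw [mem_lcmFiber, Finset.mem_singleton]
    constructor
    · rintro ⟨-, h1⟩
      funext i
      exact Nat.dvd_one.1 (h1 ▸ Finset.dvd_lcm (Finset.mem_univ i))
    · rintro rfl
      exact ⟨fun _ => le_rfl, Nat.dvd_one.1 (Finset.lcm_dvd fun _ _ => dvd_rfl)⟩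
  have hlcm : (Finset.univ : Finset (Fin r)).lcm (fun _ => 1) = 1 :=
    Nat.dvd_one.1 (Finset.lcm_dvd fun _ _ => dvd_rfl)
  rw [lcmSum, hfib, Finset.sum_singleton, etaTerm, if_pos ⟨fun _ => le_rfl, by simp, by simp⟩, hlcm]
  simp

theorem lcmSum_prime_pow_eq_zero (k r : ℕ) (h : Fin r → ℕ) (q a : ℕ) {p : ℕ} (hp : p.Prime) {e : ℕ}
    (he : 2 ≤ e) : lcmSum k r h q a (p ^ e) = 0 := by
  refine Finset.sum_eq_zero fun d hd => ?_
  obtain ⟨-, hlcm⟩ := mem_lcmFiber.1 hd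
  have hi : ∃ i, ArithmeticFunction.moebius (d i) = 0 := by
    by_contra! hne
    have hdvd : p ^ e ∣ p ^ 1 := hlcm ▸ Finset.lcm_dvd fun i _ => by
      obtain ⟨m, -, hm⟩ := (Nat.dvd_prime_pow hp).1 (hlcm ▸ Finset.dvd_lcm (Finset.mem_univ i))
      rw [hm]
      refine pow_dvd_pow _ ?_
      by_contra! h1
      refine hne i ?_
      rw [hm, ArithmeticFunction.moebius_apply_prime_pow hp (by omega), if_neg (by omega)]
    have := (Nat.pow_dvd_pow_iff_le_right hp.one_lt).1 hdvd
    omega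
  obtain ⟨i, hi⟩ := hi
  unfold etaTerm
  rw [Finset.prod_eq_zero (Finset.mem_univ i) (by rw [hi, Int.cast_zero]), zero_mul, ite_self]

theorem summable_lcmSum {k r : ℕ} (hk : 2 ≤ k) {h : Fin r → ℕ} (hh : Function.Injective h)
    {q : ℕ} (hq : 0 < q) (a : ℕ) : Summable fun D => ‖lcmSum k r h q a D‖ := by
  have hs := summable_etaTerm hk hh hq a
  let e := Equiv.sigmaFiberEquiv fun d : Fin r → ℕ => Finset.univ.lcm d
  have hs' := (e.summable_iff.2 hs).sigma
  refine Summable.of_nonneg_of_le (fun _ => norm_nonneg _) (fun D => ?_) hs'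
  rw [← (hasSum_etaTerm_lcmFiber k r h q a D).tsum_eq]
  exact norm_tsum_le_tsum_norm (hs.subtype _)

theorem tsum_lcmSum {k r : ℕ} (hk : 2 ≤ k) {h : Fin r → ℕ} (hh : Function.Injective h)
    {q : ℕ} (hq : 0 < q) (a : ℕ) :
    ∑' D, lcmSum k r h q a D = ∑' d, etaTerm k r h q a d := by
  have := (summable_etaTerm hk hh hq a).of_norm.hasSum.tsum_fiberwise
    fun d : Fin r → ℕ => Finset.univ.lcm d
  rw [← this.tsum_eq]
  exact tsum_congr fun D => (hasSum_etaTerm_lcmFiber k r h q a D).tsum_eq.symm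

/-- The tuple with entry `p` at the indices in `S` and entry `1` elsewhere. -/
def primeTuple {r : ℕ} (p : ℕ) (S : Finset (Fin r)) (i : Fin r) : ℕ := if i ∈ S then p else 1

theorem lcm_primeTuple {r p : ℕ} {S : Finset (Fin r)} (hS : S.Nonempty) :
    Finset.univ.lcm (primeTuple p S) = p := by
  refine Nat.dvd_antisymm (Finset.lcm_dvd fun i _ => ?_) ?_
  · unfold primeTuple
    split_ifs <;> simp
  · obtain ⟨i, hi⟩ := hS
    have := Finset.dvd_lcm (f := primeTuple p S) (Finset.mem_univ i)
    rwa [primeTuple, if_pos hi] at this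

theorem lcmSum_prime_eq_sum (k r : ℕ) (h : Fin r → ℕ) (q a : ℕ) {p : ℕ} (hp : p.Prime) :
    lcmSum k r h q a p =
      ∑ S : Finset (Fin r) with S.Nonempty, etaTerm k r h q a (primeTuple p S) := by
  symm
  refine Finset.sum_nbij' (primeTuple p) (fun d => Finset.univ.filter fun i => d i = p)
    ?_ ?_ ?_ ?_ fun _ _ => rfl
  · intro S hS
    rw [Finset.mem_filter] at hS
    refine mem_lcmFiber.2 ⟨fun i => ?_, lcm_primeTuple hS.2⟩
    unfold primeTuple
    split_ifs
    exacts [hp.one_le, le_rfl]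
  · intro d hd
    obtain ⟨-, hlcm⟩ := mem_lcmFiber.1 hd
    rw [Finset.mem_filter]
    refine ⟨Finset.mem_univ _, ?_⟩
    by_contra hne
    rw [Finset.not_nonempty_iff_eq_empty, Finset.filter_eq_empty_iff] at hne
    refine hp.ne_one (Nat.dvd_one.1 ?_)
    nth_rewrite 1 [← hlcm]
    refine Finset.lcm_dvd fun i _ => ?_
    have hdvd : d i ∣ p := hlcm ▸ Finset.dvd_lcm (Finset.mem_univ i)
    rw [((Nat.dvd_prime hp).1 hdvd).resolve_right (hne (Finset.mem_univ i))]
  · intro S _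
    ext i
    rw [Finset.mem_filter]
    by_cases hi : i ∈ S
    · simp [primeTuple, hi]
    · simp [primeTuple, hi, hp.ne_one.symm]
  · intro d hd
    obtain ⟨-, hlcm⟩ := mem_lcmFiber.1 hd
    funext i
    have hdvd : d i ∣ p := hlcm ▸ Finset.dvd_lcm (Finset.mem_univ i)
    simp only [primeTuple, Finset.mem_filter, Finset.mem_univ, true_and]
    split_ifs with hi
    · exact hi.symm
    · exact (((Nat.dvd_prime hp).1 hdvd).resolve_right hi).symm

theorem admissible_primeTuple {k r : ℕ} {h : Fin r → ℕ} {q a p : ℕ} (hp : p.Prime)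
    (S : Finset (Fin r)) :
    Admissible k r h q a (primeTuple p S) ↔
      (∀ i ∈ S, ∀ j ∈ S, h i % p ^ k = h j % p ^ k) ∧ ∀ i ∈ S, Nat.gcd q (p ^ k) ∣ a + h i := by
  have h1 : ∀ i, 1 ≤ primeTuple p S i := fun i => by
    unfold primeTuple
    split_ifs
    exacts [hp.one_le, le_rfl]
  have h2 : ∀ i j, ((Nat.gcd (primeTuple p S i ^ k) (primeTuple p S j ^ k) : ℤ) ∣
      (h i : ℤ) - (h j : ℤ)) ↔ (i ∈ S → j ∈ S → h i % p ^ k = h j % p ^ k) := fun i j => by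
    unfold primeTuple
    by_cases hi : i ∈ S <;> by_cases hj : j ∈ S <;> simp only [hi, hj, if_true, if_false]
    · rw [Nat.gcd_self, ← Nat.modEq_iff_dvd]
      simp only [forall_const]
      exact ⟨fun H => H.symm, fun H => Eq.symm H⟩
    all_goals simp
  have h3 : ∀ i, Nat.gcd q (primeTuple p S i ^ k) ∣ a + h i ↔
      (i ∈ S → Nat.gcd q (p ^ k) ∣ a + h i) := fun i => by
    unfold primeTuple
    by_cases hi : i ∈ S <;> simp [hi]
  simp only [Admissible, h1, h2, h3, implies_true, true_and]
  grind

theorem etaTerm_primeTuple {k r : ℕ} {h : Fin r → ℕ} {q a p : ℕ} (hp : p.Prime)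
    {S : Finset (Fin r)} (hS : S.Nonempty) :
    etaTerm k r h q a (primeTuple p S) =
      if (∀ i ∈ S, ∀ j ∈ S, h i % p ^ k = h j % p ^ k) ∧ ∀ i ∈ S, Nat.gcd q (p ^ k) ∣ a + h i
      then (-1) ^ S.card * ((Nat.gcd q (p ^ k) : ℕ) / (p : ℝ) ^ k) else 0 := by
  have hmu : ∏ i, (ArithmeticFunction.moebius (primeTuple p S i) : ℝ) = (-1) ^ S.card := by
    have : ∀ i, (ArithmeticFunction.moebius (primeTuple p S i) : ℝ) =
        if i ∈ S then -1 else 1 := fun i => by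
      unfold primeTuple
      split_ifs
      · rw [ArithmeticFunction.moebius_apply_prime hp]; norm_num
      · rw [ArithmeticFunction.moebius_apply_one]; norm_num
    simp only [this, Finset.prod_ite_mem, Finset.univ_inter, Finset.prod_const]
  unfold etaTerm
  rw [lcm_primeTuple hS, hmu]
  exact if_congr (admissible_primeTuple hp S) rfl rfl

/-- The residues `H` of the shifts modulo `p ^ k` for which the congruence class `a` modulo `q`
meets the class of `-H` modulo `p ^ k`. -/
def residuesMeeting (k r : ℕ) (h : Fin r → ℕ) (q a p : ℕ) : Finset ℕ :=
  (residues k r h p).filter fun H => Nat.gcd q (p ^ k) ∣ a + H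

theorem gcd_dvd_add_mod {k q a p n : ℕ} :
    Nat.gcd q (p ^ k) ∣ a + n % p ^ k ↔ Nat.gcd q (p ^ k) ∣ a + n := by
  have h1 : n % p ^ k ≡ n [MOD Nat.gcd q (p ^ k)] :=
    (Nat.mod_modEq n (p ^ k)).of_dvd (Nat.gcd_dvd_right _ _)
  exact (h1.add_left a).dvd_iff dvd_rfl

theorem sum_neg_one_pow_card_residue_classes (k r : ℕ) (h : Fin r → ℕ) (q a p : ℕ) :
    ∑ S : Finset (Fin r) with S.Nonempty ∧ ((∀ i ∈ S, ∀ j ∈ S, h i % p ^ k = h j % p ^ k) ∧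
        ∀ i ∈ S, Nat.gcd q (p ^ k) ∣ a + h i), (-1 : ℝ) ^ S.card =
      -((residuesMeeting k r h q a p).card : ℝ) := by
  let cls : ℕ → Finset (Fin r) := fun H => Finset.univ.filter fun i => h i % p ^ k = H
  have hF : (Finset.univ.filter fun S : Finset (Fin r) => S.Nonempty ∧
      ((∀ i ∈ S, ∀ j ∈ S, h i % p ^ k = h j % p ^ k) ∧
        ∀ i ∈ S, Nat.gcd q (p ^ k) ∣ a + h i)) =
      (residuesMeeting k r h q a p).biUnion fun H => (cls H).powerset.erase ∅ := by
    ext S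
    simp only [Finset.mem_filter, Finset.mem_univ, true_and, Finset.mem_biUnion,
      Finset.mem_erase, Finset.mem_powerset, residuesMeeting, residues, Finset.mem_image]
    constructor
    · rintro ⟨⟨i, hi⟩, h1, h2⟩
      refine ⟨h i % p ^ k, ⟨⟨i, rfl⟩, gcd_dvd_add_mod.2 (h2 i hi)⟩,
        Finset.Nonempty.ne_empty ⟨i, hi⟩, fun j hj => ?_⟩
      exact Finset.mem_filter.2 ⟨Finset.mem_univ _, h1 j hj i hi⟩
    · rintro ⟨H, ⟨-, hH⟩, hne, hsub⟩
      have hmem : ∀ i ∈ S, h i % p ^ k = H := fun i hi => (Finset.mem_filter.1 (hsub hi)).2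
      refine ⟨Finset.nonempty_iff_ne_empty.2 hne,
        fun i hi j hj => (hmem i hi).trans (hmem j hj).symm, fun i hi => ?_⟩
      rw [← gcd_dvd_add_mod, hmem i hi]
      exact hH
  rw [hF, Finset.sum_biUnion]
  · have hcls : ∀ H ∈ residuesMeeting k r h q a p,
        ∑ S ∈ (cls H).powerset.erase ∅, (-1 : ℝ) ^ S.card = -1 := fun H hH => by
      obtain ⟨i, -, hi⟩ := Finset.mem_image.1 (Finset.mem_filter.1 hH).1
      have h0 : ∑ S ∈ (cls H).powerset, (-1 : ℝ) ^ S.card = 0 := by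
        exact_mod_cast Finset.sum_powerset_neg_one_pow_card_of_nonempty
          (x := cls H) ⟨i, Finset.mem_filter.2 ⟨Finset.mem_univ _, hi⟩⟩
      rw [← Finset.add_sum_erase _ _ (Finset.empty_mem_powerset _)] at h0
      rw [Finset.card_empty, pow_zero] at h0
      linarith
    rw [Finset.sum_congr rfl hcls]
    simp
  · intro H _ H' _ hne
    rw [Function.onFun, Finset.disjoint_left]
    intro S hS hS'
    rw [Finset.mem_erase, Finset.mem_powerset] at hS hS'
    obtain ⟨i, hi⟩ := Finset.nonempty_iff_ne_empty.2 hS.1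
    exact hne ((Finset.mem_filter.1 (hS.2 hi)).2.symm.trans (Finset.mem_filter.1 (hS'.2 hi)).2)

theorem lcmSum_prime (k r : ℕ) (h : Fin r → ℕ) (q a : ℕ) {p : ℕ} (hp : p.Prime) :
    lcmSum k r h q a p =
      -((Nat.gcd q (p ^ k) : ℕ) / (p : ℝ) ^ k * (residuesMeeting k r h q a p).card) := by
  rw [lcmSum_prime_eq_sum k r h q a hp,
    Finset.sum_congr rfl fun S hS => etaTerm_primeTuple hp (Finset.mem_filter.1 hS).2,
    ← Finset.sum_filter, Finset.filter_filter, ← Finset.sum_mul,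
    sum_neg_one_pow_card_residue_classes]
  ring

theorem tsum_lcmSum_prime_pow (k r : ℕ) (h : Fin r → ℕ) (q a : ℕ) {p : ℕ} (hp : p.Prime) :
    ∑' e, lcmSum k r h q a (p ^ e) =
      1 - (Nat.gcd q (p ^ k) : ℕ) / (p : ℝ) ^ k * (residuesMeeting k r h q a p).card := by
  rw [tsum_eq_sum (s := Finset.range 2) fun e he =>
    lcmSum_prime_pow_eq_zero k r h q a hp (not_lt.1 (mt Finset.mem_range.2 he))]
  rw [Finset.sum_range_succ, Finset.sum_range_one, pow_zero, pow_one, lcmSum_one,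
    lcmSum_prime k r h q a hp]
  ring

/-- The Euler product of `q * eta k r h q a`. -/
theorem hasProd_mul_eta {k r : ℕ} (hk : 2 ≤ k) {h : Fin r → ℕ} (hh : Function.Injective h)
    {q : ℕ} (hq : 0 < q) (a : ℕ) :
    HasProd (fun p : Nat.Primes => (1 : ℝ) -
      (Nat.gcd q ((p : ℕ) ^ k) : ℕ) / ((p : ℕ) : ℝ) ^ k * (residuesMeeting k r h q a p).card)
      (q * eta k r h q a) := by
  have := EulerProduct.eulerProduct_hasProd (f := lcmSum k r h q a) (lcmSum_one k r h q a)
    (fun hmn => lcmSum_mul k r h q a hmn) (summable_lcmSum hk hh hq a) (lcmSum_zero k r h q a)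
  rw [mul_eta_eq_tsum k r h hq, ← tsum_lcmSum hk hh hq]
  exact this.congr_fun fun p => (tsum_lcmSum_prime_pow k r h q a p.2).symm

theorem residuesMeeting_of_gcd_eq_one {k r : ℕ} {h : Fin r → ℕ} {q a p : ℕ}
    (hg : Nat.gcd q (p ^ k) = 1) : (residuesMeeting k r h q a p).card = Rp k r h p := by
  rw [residuesMeeting, Finset.filter_true_of_mem fun _ _ => hg ▸ one_dvd _]
  rfl

theorem hasProd_rho {k r : ℕ} (hk : 2 ≤ k) {h : Fin r → ℕ} (hh : Function.Injective h) :
    HasProd (fun p : Nat.Primes => (1 : ℝ) - (Rp k r h (p : ℕ) : ℝ) / ((p : ℕ) : ℝ) ^ k)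
      (rho k r h) := by
  have := hasProd_mul_eta hk hh one_pos 0
  simp only [residuesMeeting_of_gcd_eq_one (Nat.gcd_one_left _), Nat.gcd_one_left, Nat.cast_one,
    one_div_mul_eq_div] at this
  exact this.multipliable.hasProd

theorem eta_prime_pow {k r : ℕ} (hk : 2 ≤ k) {h : Fin r → ℕ} (hh : Function.Injective h)
    (p : Nat.Primes) (hR : Rp k r h p < (p : ℕ) ^ k) (l a : ℕ) :
    eta k r h ((p : ℕ) ^ l) a =
      rho k r h / (1 - Rp k r h p / ((p : ℕ) : ℝ) ^ k) / ((p : ℕ) : ℝ) ^ l *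
      (1 - (Nat.gcd ((p : ℕ) ^ l) ((p : ℕ) ^ k) : ℕ) / ((p : ℕ) : ℝ) ^ k *
        (residuesMeeting k r h ((p : ℕ) ^ l) a p).card) := by
  have hp : Nat.Prime (p : ℕ) := p.2
  have hpk : (0 : ℝ) < ((p : ℕ) : ℝ) ^ k := pow_pos (by exact_mod_cast hp.pos) k
  have hpl : (0 : ℝ) < ((p : ℕ) : ℝ) ^ l := pow_pos (by exact_mod_cast hp.pos) l
  have hR' : (Rp k r h p : ℝ) < ((p : ℕ) : ℝ) ^ k := by exact_mod_cast hR
  have hne : (1 : ℝ) - Rp k r h p / ((p : ℕ) : ℝ) ^ k ≠ 0 :=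
    (sub_pos.2 ((div_lt_one hpk).2 hR')).ne'
  have hupd := (hasProd_rho hk hh).update' p
    (1 - (Nat.gcd ((p : ℕ) ^ l) ((p : ℕ) ^ k) : ℕ) / ((p : ℕ) : ℝ) ^ k *
      (residuesMeeting k r h ((p : ℕ) ^ l) a p).card)
    ((hasProd_mul_eta hk hh (pow_pos hp.pos l) a).congr_fun fun p' => by
      by_cases hpp : p' = p
      · subst hpp
        rw [Function.update_self]
      · have hg : Nat.gcd ((p : ℕ) ^ l) ((p' : ℕ) ^ k) = 1 :=
          ((Nat.coprime_primes hp p'.2).2 fun H => hpp (Subtype.ext H.symm)).pow l k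
        rw [Function.update_of_ne hpp, residuesMeeting_of_gcd_eq_one hg, hg, Nat.cast_one,
          one_div_mul_eq_div])
  rw [div_div, div_mul_eq_mul_div, eq_div_iff (mul_ne_zero hne hpl.ne'), hupd]
  push_cast
  ring

theorem eF_add (x y : ℝ) : eF (x + y) = eF x * eF y := by
  rw [eF, eF, eF, ← Complex.exp_add]
  push_cast
  ring_nf

theorem eF_div_eq_one_iff {n : ℕ} (hn : 0 < n) (m : ℤ) : eF ((m : ℝ) / n) = 1 ↔ (n : ℤ) ∣ m := by
  have hn' : (n : ℂ) ≠ 0 := by exact_mod_cast hn.ne'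
  rw [eF, Complex.exp_eq_one_iff]
  refine exists_congr fun c => ?_
  have hpi : (2 * Real.pi * Complex.I : ℂ) ≠ 0 := Complex.two_pi_I_ne_zero
  rw [mul_comm (c : ℂ), mul_right_inj' hpi]
  push_cast
  rw [div_eq_iff hn', mul_comm]
  exact_mod_cast Iff.rfl

theorem eF_div_eq_of_dvd_sub {n : ℕ} (hn : 0 < n) {m m' : ℤ} (hd : (n : ℤ) ∣ m - m') :
    eF ((m : ℝ) / n) = eF ((m' : ℝ) / n) := by
  have : (m : ℝ) / n = ((m - m' : ℤ) : ℝ) / n + (m' : ℝ) / n := by push_cast; ring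
  rw [this, eF_add, (eF_div_eq_one_iff hn _).2 hd, one_mul]

theorem sum_Icc_add_of_periodic {n : ℕ} {F : ℕ → ℂ}
    (hF : ∀ i, F (i + n) = F i) (g : ℕ) :
    ∑ i ∈ Finset.Icc 1 n, F (i + g) = ∑ i ∈ Finset.Icc 1 n, F i := by
  induction g with
  | zero => rfl
  | succ g ih =>
    rw [← ih]
    have hIcc : ∀ G : ℕ → ℂ, ∑ i ∈ Finset.Icc 1 n, G i = ∑ i ∈ Finset.range n, G (i + 1) :=
      fun G => by
        rw [Finset.range_eq_Ico, Finset.sum_Ico_add']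
        rfl
    rw [hIcc, hIcc]
    have h1 := Finset.sum_range_succ (fun i => F (i + 1 + g)) n
    rw [Finset.sum_range_succ'] at h1
    have h2 : F (n + 1 + g) = F (0 + 1 + g) := by
      rw [← hF (0 + 1 + g)]
      congr 1
      ring
    have h3 : ∀ i, F (i + 1 + (g + 1)) = F (i + 1 + 1 + g) := fun i => by
      congr 1
      ring
    simp only [h3]
    linear_combination h1 + h2

theorem sum_Icc_eq_zero_of_shift {n g : ℕ} {F : ℕ → ℂ} {c : ℂ} (hc : c ≠ 1)
    (hF : ∀ i, F (i + n) = F i) (hg : ∀ i, F (i + g) = c * F i) :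
    ∑ i ∈ Finset.Icc 1 n, F i = 0 := by
  have hs := sum_Icc_add_of_periodic hF g
  simp only [hg, ← Finset.mul_sum] at hs
  have : (c - 1) * ∑ i ∈ Finset.Icc 1 n, F i = 0 := by linear_combination hs
  exact (mul_eq_zero.1 this).resolve_left (sub_ne_zero.2 hc)

theorem eF_nat_mul_add {n : ℕ} (a i g : ℕ) :
    eF (((a * (i + g) : ℕ) : ℝ) / n) = eF (((a * g : ℕ) : ℝ) / n) * eF (((a * i : ℕ) : ℝ) / n) := by
  rw [← eF_add]
  push_cast
  ring_nf

theorem eF_nat_mul_add_period {n : ℕ} (hn : 0 < n) (a i : ℕ) :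
    eF (((a * (i + n) : ℕ) : ℝ) / n) = eF (((a * i : ℕ) : ℝ) / n) := by
  have h1 : eF (((a * n : ℕ) : ℝ) / n) = 1 := by
    have := (eF_div_eq_one_iff hn ((a * n : ℕ) : ℤ)).2 (by push_cast; exact dvd_mul_left _ _)
    rwa [Int.cast_natCast] at this
  rw [eF_nat_mul_add, h1, one_mul]

/-- An exponential sum over an arithmetic progression whose difference does not resolve the
frequency vanishes. -/
theorem sum_eF_progression_eq_zero {n g a : ℕ} (hn : 0 < n) (hgn : g ∣ n) (hag : ¬ n ∣ a * g)
    (H : ℕ) :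
    ∑ ν ∈ Finset.Icc 1 n, (if g ∣ ν + H then eF (((a * ν : ℕ) : ℝ) / n) else 0) = 0 := by
  refine sum_Icc_eq_zero_of_shift (g := g) (c := eF (((a * g : ℕ) : ℝ) / n))
    (fun h1 => hag ?_) (fun i => ?_) fun i => ?_
  · have := (eF_div_eq_one_iff hn ((a * g : ℕ) : ℤ)).1 (by rwa [Int.cast_natCast])
    exact_mod_cast this
  · simp only [eF_nat_mul_add_period hn, add_right_comm i n, Nat.dvd_add_left hgn]
  · simp only [eF_nat_mul_add, add_right_comm i g, Nat.dvd_add_self_right, mul_ite, mul_zero]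

theorem sum_eF_single_class {n : ℕ} (hn : 0 < n) (a H : ℕ) :
    ∑ ν ∈ Finset.Icc 1 n, (if n ∣ ν + H then eF (((a * ν : ℕ) : ℝ) / n) else 0) =
      eF (-(((a * H : ℕ) : ℝ) / n)) := by
  have h1 : ∀ ν, (if n ∣ ν + H then eF (((a * ν : ℕ) : ℝ) / n) else 0) =
      (if n ∣ ν + H then eF (-(((a * H : ℕ) : ℝ) / n)) else 0) := fun ν => by
    split_ifs with hd
    · have := eF_div_eq_of_dvd_sub hn (m := ((a * ν : ℕ) : ℤ)) (m' := -((a * H : ℕ) : ℤ)) (by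
        have : (n : ℤ) ∣ (ν + H : ℕ) := by exact_mod_cast hd
        rw [sub_neg_eq_add, ← Nat.cast_add, ← mul_add]
        push_cast at this ⊢
        exact dvd_mul_of_dvd_right this _)
      rwa [Int.cast_neg, Int.cast_natCast, Int.cast_natCast, neg_div] at this
    · rfl
  simp only [h1]
  rw [sum_Icc_add_of_periodic
    (F := fun ν => if n ∣ ν then eF (-(((a * H : ℕ) : ℝ) / n)) else 0)
    (fun i => by simp only [Nat.dvd_add_self_right]) H]
  rw [Finset.sum_eq_single n, if_pos dvd_rfl]
  · intro b hb hbn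
    rw [Finset.mem_Icc] at hb
    exact if_neg fun hd => hbn (le_antisymm hb.2 (Nat.le_of_dvd hb.1 hd))
  · intro hn'
    exact absurd (Finset.mem_Icc.2 ⟨hn, le_rfl⟩) hn'

theorem sum_eF_mul_card_residuesMeeting (k r : ℕ) (h : Fin r → ℕ) (q p n a : ℕ) :
    ∑ ν ∈ Finset.Icc 1 n, eF (((a * ν : ℕ) : ℝ) / n) * ((residuesMeeting k r h q ν p).card : ℂ) =
      ∑ H ∈ residues k r h p, ∑ ν ∈ Finset.Icc 1 n,
        if Nat.gcd q (p ^ k) ∣ ν + H then eF (((a * ν : ℕ) : ℝ) / n) else 0 := by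
  rw [Finset.sum_comm]
  refine Finset.sum_congr rfl fun ν _ => ?_
  rw [← Finset.sum_filter, Finset.sum_const, nsmul_eq_mul, mul_comm, residuesMeeting]

/-- the Gauss sum of the `k`-free `r`-tuples at `a/p^l`. -/
theorem stmt_7 (k r : ℕ) (hk : 2 ≤ k) (hr : 1 ≤ r) (h : Fin r → ℕ) (hh : StrictMono h)
    (hRp : ∀ p : ℕ, p.Prime → Rp k r h p < p ^ k)
    (p : ℕ) (hp : p.Prime) (l : ℕ) (hl : 1 ≤ l) (a : ℕ) (ha : 1 ≤ a) (hpa : ¬ p ∣ a) :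
    ∑ ν ∈ Finset.Icc 1 (p ^ l),
        eF (((a * ν : ℕ) : ℝ) / ((p : ℝ) ^ l)) * (eta k r h (p ^ l) ν : ℂ)
      = if l ≤ k then
          (rho k r h : ℂ) *
            (-((p : ℂ) ^ k)⁻¹ / (1 - (Rp k r h p : ℂ) * ((p : ℂ) ^ k)⁻¹)) *
            ∑ H ∈ residues k r h p, eF (-(((a * H : ℕ) : ℝ) / ((p : ℝ) ^ l)))
        else 0 := by
  have hn : 0 < p ^ l := pow_pos hp.pos l
  have heta : ∀ ν, eta k r h (p ^ l) ν = _ := eta_prime_pow hk hh.injective ⟨p, hp⟩ (hRp p hp) l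
  simp only at heta
  have hfull : ∑ ν ∈ Finset.Icc 1 (p ^ l), eF (((a * ν : ℕ) : ℝ) / (p ^ l : ℕ)) = 0 := by
    have := sum_eF_progression_eq_zero hn (one_dvd _) (a := a)
      (fun hd => hpa ((dvd_pow_self p (Nat.one_le_iff_ne_zero.1 hl)).trans (by simpa using hd))) 0
    simpa only [one_dvd, if_true] using this
  have hsum := sum_eF_mul_card_residuesMeeting k r h (p ^ l) p (p ^ l) a
  have hpk : (p : ℂ) ^ k ≠ 0 := pow_ne_zero _ (by exact_mod_cast hp.ne_zero)
  have hpl : (p : ℂ) ^ l ≠ 0 := pow_ne_zero _ (by exact_mod_cast hp.ne_zero)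
  set A : ℂ := rho k r h / (1 - Rp k r h p / (p : ℂ) ^ k) / (p : ℂ) ^ l with hA
  have hsplit : ∑ ν ∈ Finset.Icc 1 (p ^ l),
        eF (((a * ν : ℕ) : ℝ) / ((p : ℝ) ^ l)) * (eta k r h (p ^ l) ν : ℂ) =
      -(A * ((Nat.gcd (p ^ l) (p ^ k) : ℕ) / (p : ℂ) ^ k) *
        ∑ ν ∈ Finset.Icc 1 (p ^ l), eF (((a * ν : ℕ) : ℝ) / (p ^ l : ℕ)) *
          ((residuesMeeting k r h (p ^ l) ν p).card : ℂ)) := by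
    rw [Finset.mul_sum, ← Finset.sum_neg_distrib, ← sub_eq_zero, ← Finset.sum_sub_distrib,
      ← mul_zero A, ← hfull, Finset.mul_sum]
    refine Finset.sum_congr rfl fun ν _ => ?_
    rw [heta, hA]
    push_cast
    ring
  rw [hsplit, hsum]
  split_ifs with hlk
  · rw [Nat.gcd_eq_left (pow_dvd_pow p hlk)]
    simp only [sum_eF_single_class hn]
    rw [hA]
    push_cast
    field_simp
  · rw [Nat.gcd_eq_right (pow_dvd_pow p (by omega))]
    have hnd : ¬ p ^ l ∣ a * p ^ k := fun hd => by
      have h1 : p ^ k * p ∣ p ^ k * a := by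
        rw [← pow_succ, mul_comm _ a]
        exact (pow_dvd_pow p (by omega)).trans hd
      exact hpa (Nat.dvd_of_mul_dvd_mul_left (pow_pos hp.pos k) h1)
    simp only [sum_eF_progression_eq_zero hn (pow_dvd_pow p (by omega : k ≤ l)) hnd,
      Finset.sum_const_zero, mul_zero, neg_zero]
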